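/- arXiv:2205.06429 — 8 statements merged into one kernel-verified Lean document; each statement's English description precedes it below -/
import Mathlib

section
/- Let V and W be the (p−1)×(p−1) matrices over K with rows and columns indexed by 0,…,p−2, defined by V_{i,j} = β^{r^{i+j}} and W_{i,j} = (β^{r^{i+j}})^{−1} − 1. Then V·W = p·I, where I is the (p−1)×(p−1) identity matrix. -/
theorem sum_pow_gen (p : ℕ) [Fact p.Prime] {K : Type*} [Field K]
    (r : ZMod p) (hr : orderOf r = p - 1) (f : ZMod p → K) :
    ∑ j : Fin (p - 1), f (r ^ (j : ℕ)) = ∑ x, f x - f 0 := by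
  have hp : p.Prime := Fact.out
  have hpos : 0 < p - 1 := by have := hp.two_le; omega
  have hr0 : r ≠ 0 := by
    rintro rfl
    have h := pow_orderOf_eq_one (0 : ZMod p)
    rw [hr, zero_pow hpos.ne'] at h
    exact zero_ne_one h
  have hinj : Function.Injective (fun j : Fin (p - 1) => r ^ (j : ℕ)) := by
    intro a b h
    apply Fin.ext
    exact pow_injOn_Iio_orderOf (by simp [hr]) (by simp [hr]) h
  have himg : Finset.univ.image (fun j : Fin (p - 1) => r ^ (j : ℕ))
      = Finset.univ.erase (0 : ZMod p) := by
    apply Finset.eq_of_subset_of_card_le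
    · intro x hx
      obtain ⟨j, -, rfl⟩ := Finset.mem_image.1 hx
      exact Finset.mem_erase.2 ⟨pow_ne_zero _ hr0, Finset.mem_univ _⟩
    · rw [Finset.card_image_of_injective _ hinj, Finset.card_erase_of_mem (Finset.mem_univ _)]
      simp [ZMod.card]
  rw [← Finset.sum_erase_add _ _ (Finset.mem_univ (0 : ZMod p)), ← himg,
    Finset.sum_image (fun a _ b _ h => hinj h)]
  simp

/-- With `V i j = β^{r^{i+j}}` and `W i j = (β^{r^{i+j}})⁻¹ - 1`, one has `V ⬝ W = p • I`. -/
theorem stmt_5 (p : ℕ) (hp : p.Prime) (K : Type*) [Field K] [Algebra ℚ K]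
    (β : K) (hβ : IsPrimitiveRoot β p)
    (r : ℕ) (hr : orderOf (r : ZMod p) = p - 1)
    (V W : Matrix (Fin (p - 1)) (Fin (p - 1)) K)
    (hV : ∀ i j, V i j = β ^ (r ^ ((i : ℕ) + (j : ℕ))))
    (hW : ∀ i j, W i j = (β ^ (r ^ ((i : ℕ) + (j : ℕ))))⁻¹ - 1) :
    V * W = (p : K) • 1 := by
  haveI : Fact p.Prime := ⟨hp⟩
  haveI : NeZero p := ⟨hp.ne_zero⟩
  have hpos : 0 < p - 1 := by have := hp.two_le; omega
  have hr0 : (r : ZMod p) ≠ 0 := by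
    intro h0
    have h := pow_orderOf_eq_one (r : ZMod p)
    rw [hr, h0, zero_pow hpos.ne'] at h
    exact zero_ne_one h
  let ψ : AddChar (ZMod p) K := AddChar.zmodChar p hβ.pow_eq_one
  have hprim : ψ.IsPrimitive := AddChar.zmodChar_primitive_of_primitive_root p hβ
  have hψ : ∀ n : ℕ, ψ (n : ZMod p) = β ^ n := AddChar.zmodChar_apply' hβ.pow_eq_one
  have key : ∀ b : ZMod p, ∑ j : Fin (p - 1), ψ ((r : ZMod p) ^ (j : ℕ) * b)
      = (if b = 0 then (p : K) else 0) - 1 := by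
    intro b
    rw [sum_pow_gen p _ hr (fun x => ψ (x * b)), AddChar.sum_mulShift b hprim]
    simp [ZMod.card]
  ext i k
  have hterm : ∀ j : Fin (p - 1), V i j * W j k =
      ψ ((r : ZMod p) ^ (j : ℕ) * ((r : ZMod p) ^ (i : ℕ) - (r : ZMod p) ^ (k : ℕ)))
      - ψ ((r : ZMod p) ^ (j : ℕ) * (r : ZMod p) ^ (i : ℕ)) := by
    intro j
    rw [hV, hW, ← hψ, ← hψ, ← AddChar.map_neg_eq_inv, mul_sub, mul_one, ← AddChar.map_add_eq_mul]
    congr 2 <;> push_cast <;> ring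
  rw [Matrix.mul_apply, Finset.sum_congr rfl (fun j _ => hterm j), Finset.sum_sub_distrib,
    key, key, if_neg (pow_ne_zero _ hr0)]
  have hik : (r : ZMod p) ^ (i : ℕ) - (r : ZMod p) ^ (k : ℕ) = 0 ↔ i = k := by
    rw [sub_eq_zero]
    constructor
    · intro h
      exact Fin.ext (pow_injOn_Iio_orderOf (by simp [hr]) (by simp [hr]) h)
    · rintro rfl; rfl
  simp [hik, Matrix.one_apply]
end

section
/- Let C be a (p−1)×(p−1) matrix over ℚ (rows and columns indexed by 0,…,p−2), and define μ_j = (1/p)·Σ_{k=0}^{p−2} ((β^{r^{j+k}})^{−1} − 1)·(Σ_{l=0}^{p−2} C_{k,l}·β^{r^l}) for 0 ≤ j ≤ p−2. Then for every i with 0 ≤ i ≤ p−2 one has Σ_{j=0}^{p−2} μ_j·β^{r^{i+j}} = Σ_{l=0}^{p−2} C_{i,l}·β^{r^l}. (This is the explicit formula recovering the skew polynomial φ^{−1}(C) from the matrix C.) -/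
lemma aux_inj (p : ℕ) (r : ℕ) (hr : orderOf (r : ZMod p) = p - 1)
    {i k : ℕ} (hi : i < p - 1) (hk : k < p - 1) (h : r ^ i % p = r ^ k % p) : i = k := by
  have h1 : ((r ^ i : ℕ) : ZMod p) = ((r ^ k : ℕ) : ZMod p) :=
    (ZMod.natCast_eq_natCast_iff' _ _ _).2 h
  push_cast at h1
  exact pow_injOn_Iio_orderOf (by simpa [hr] using hi) (by simpa [hr] using hk) h1

lemma aux_ne (p : ℕ) (hp : p.Prime) (r : ℕ) (hr : orderOf (r : ZMod p) = p - 1) :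
    ¬ p ∣ r := by
  intro h
  haveI := Fact.mk hp
  have h0 : (r : ZMod p) = 0 := (ZMod.natCast_eq_zero_iff _ _).2 h
  have h1 := pow_orderOf_eq_one (r : ZMod p)
  have := hp.two_le
  rw [hr, h0, zero_pow (by omega)] at h1
  exact zero_ne_one h1

lemma aux_sum (p : ℕ) (hp : p.Prime) {K : Type*} [Field K]
    (r : ℕ) (hr : orderOf (r : ZMod p) = p - 1) (x : K) (hx : x ^ p = 1) (h1 : x ≠ 1) :
    ∑ j : Fin (p - 1), x ^ (r ^ (j : ℕ)) = -1 := by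
  have himg : (Finset.univ : Finset (Fin (p - 1))).image (fun j : Fin (p - 1) => r ^ (j : ℕ) % p)
      = (Finset.range p).erase 0 := by
    apply Finset.eq_of_subset_of_card_le
    · intro m hm
      simp only [Finset.mem_image, Finset.mem_univ, true_and] at hm
      obtain ⟨j, rfl⟩ := hm
      simp only [Finset.mem_erase, Finset.mem_range]
      refine ⟨fun h => aux_ne p hp r hr (hp.dvd_of_dvd_pow (Nat.dvd_of_mod_eq_zero h)),
        Nat.mod_lt _ hp.pos⟩
    · rw [Finset.card_image_of_injective, Finset.card_erase_of_mem]
      · simp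
      · simpa using hp.pos
      · intro i k h
        exact Fin.ext (aux_inj p r hr i.2 k.2 h)
  have hg : ∑ m ∈ Finset.range p, x ^ m = 0 := by
    rw [geom_sum_eq h1, hx]; simp
  rw [← Finset.add_sum_erase _ _ (Finset.mem_range.2 hp.pos), ← himg, Finset.sum_image] at hg
  · simp only [← pow_eq_pow_mod _ hx, pow_zero] at hg
    linear_combination hg
  · intro i _ k _ h
    exact Fin.ext (aux_inj p r hr i.2 k.2 h)

lemma aux_orth (p : ℕ) (hp : p.Prime) {K : Type*} [Field K]
    (β : K) (hβ : IsPrimitiveRoot β p)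
    (r : ℕ) (hr : orderOf (r : ZMod p) = p - 1) (i k : Fin (p - 1)) :
    ∑ j : Fin (p - 1), ((β ^ (r ^ ((j : ℕ) + (k : ℕ))))⁻¹ - 1) * β ^ (r ^ ((i : ℕ) + (j : ℕ)))
      = if k = i then (p : K) else 0 := by
  have hb0 : β ≠ 0 := hβ.ne_zero hp.ne_zero
  have hz : (β ^ (r ^ (i : ℕ))) ^ p = 1 := by
    rw [← pow_mul, mul_comm, pow_mul, hβ.pow_eq_one, one_pow]
  have hz' : (β ^ (r ^ (k : ℕ))) ^ p = 1 := by
    rw [← pow_mul, mul_comm, pow_mul, hβ.pow_eq_one, one_pow]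
  have hz1 : β ^ (r ^ (i : ℕ)) ≠ 1 := fun h =>
    aux_ne p hp r hr (hp.dvd_of_dvd_pow ((hβ.pow_eq_one_iff_dvd _).1 h))
  have hterm : ∀ j : Fin (p - 1),
      ((β ^ (r ^ ((j : ℕ) + (k : ℕ))))⁻¹ - 1) * β ^ (r ^ ((i : ℕ) + (j : ℕ)))
      = (β ^ (r ^ (i : ℕ)) / β ^ (r ^ (k : ℕ))) ^ (r ^ (j : ℕ))
        - (β ^ (r ^ (i : ℕ))) ^ (r ^ (j : ℕ)) := by
    intro j
    rw [div_pow, ← pow_mul, ← pow_mul, ← pow_add, ← pow_add, add_comm (j : ℕ) (k : ℕ)]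
    ring
  rw [Finset.sum_congr rfl fun j _ => hterm j, Finset.sum_sub_distrib,
    aux_sum p hp r hr _ hz hz1]
  split_ifs with h
  · subst h
    rw [div_self (pow_ne_zero _ hb0)]
    simp [Nat.cast_sub hp.one_le]
  · rw [aux_sum p hp r hr]
    · ring
    · rw [div_pow, hz, hz', div_one]
    · intro hd
      rw [div_eq_one_iff_eq (pow_ne_zero _ hb0)] at hd
      apply h
      rw [pow_eq_pow_mod _ hβ.pow_eq_one, pow_eq_pow_mod (r ^ (k : ℕ)) hβ.pow_eq_one] at hd
      exact Fin.ext (aux_inj p r hr k.2 i.2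
        (hβ.pow_inj (Nat.mod_lt _ hp.pos) (Nat.mod_lt _ hp.pos) hd).symm)

/-- The explicit formula recovering the coefficients `μ_j` of the skew polynomial
`φ⁻¹(C)` from a rational matrix `C`. -/
theorem stmt_6 (p : ℕ) (hp : p.Prime) (K : Type*) [Field K] [Algebra ℚ K]
    (β : K) (hβ : IsPrimitiveRoot β p)
    (r : ℕ) (hr : orderOf (r : ZMod p) = p - 1)
    (C : Matrix (Fin (p - 1)) (Fin (p - 1)) ℚ)
    (μ : Fin (p - 1) → K)
    (hμ : ∀ j : Fin (p - 1), μ j = (p : K)⁻¹ *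
      ∑ k : Fin (p - 1), ((β ^ (r ^ ((j : ℕ) + (k : ℕ))))⁻¹ - 1) *
        (∑ l : Fin (p - 1), (C k l : K) * β ^ (r ^ (l : ℕ)))) :
    ∀ i : Fin (p - 1),
      ∑ j : Fin (p - 1), μ j * β ^ (r ^ ((i : ℕ) + (j : ℕ))) =
        ∑ l : Fin (p - 1), (C i l : K) * β ^ (r ^ (l : ℕ)) := by
  intro i
  haveI : CharZero K := algebraRat.charZero K
  have hpK : (p : K) ≠ 0 := Nat.cast_ne_zero.2 hp.ne_zero
  set S : Fin (p - 1) → K := fun k => ∑ l : Fin (p - 1), (C k l : K) * β ^ (r ^ (l : ℕ)) with hS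
  change _ = S i
  calc ∑ j : Fin (p - 1), μ j * β ^ (r ^ ((i : ℕ) + (j : ℕ)))
      = ∑ j : Fin (p - 1), ∑ k : Fin (p - 1), (p : K)⁻¹ * S k *
        (((β ^ (r ^ ((j : ℕ) + (k : ℕ))))⁻¹ - 1) * β ^ (r ^ ((i : ℕ) + (j : ℕ)))) := by
        refine Finset.sum_congr rfl fun j _ => ?_
        rw [hμ j, Finset.mul_sum, Finset.sum_mul]
        refine Finset.sum_congr rfl fun k _ => ?_
        simp only [hS]
        ring
    _ = S i := by
        rw [Finset.sum_comm]
        simp only [← Finset.mul_sum, aux_orth p hp β hβ r hr i]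
        simp only [mul_ite, mul_zero, Finset.sum_ite_eq', Finset.mem_univ, if_true]
        field_simp
end

section
/- The sum of the powers Y^1 + Y^2 + ⋯ + Y^{p−1} equals −I, where I is the (p−1)×(p−1) identity matrix over ℚ. -/
/-- `Y + Y² + ⋯ + Y^{p-1} = -I`. -/
theorem stmt_8 (p : ℕ) (hp : p.Prime)
    (r : ℕ) (hr : orderOf (r : ZMod p) = p - 1)
    (Y : Matrix (Fin (p - 1)) (Fin (p - 1)) ℚ)
    (hY : ∀ i j, Y i j =
      if (r : ZMod p) ^ (i : ℕ) + 1 = 0 then -1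
      else if (r : ZMod p) ^ (j : ℕ) = (r : ZMod p) ^ (i : ℕ) + 1 then 1 else 0) :
    ∑ j ∈ Finset.Icc 1 (p - 1), Y ^ j = -1 := by
  haveI : Fact p.Prime := ⟨hp⟩
  have hp2 := hp.two_le
  set g : ZMod p := (r : ZMod p) with hg
  have hg0 : g ≠ 0 := by
    intro h
    rw [h, orderOf_zero] at hr
    omega
  have hinj : ∀ i j : Fin (p - 1), g ^ (i : ℕ) = g ^ (j : ℕ) → i = j := by
    intro i j h
    apply Fin.ext
    exact pow_injOn_Iio_orderOf (by simpa [hr] using i.2) (by simpa [hr] using j.2) h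
  have himg : (Finset.univ : Finset (Fin (p - 1))).image (fun i : Fin (p - 1) => g ^ (i : ℕ))
      = Finset.univ.erase 0 := by
    apply Finset.eq_of_subset_of_card_le
    · intro x hx
      simp only [Finset.mem_image, Finset.mem_univ, true_and] at hx
      obtain ⟨i, rfl⟩ := hx
      simp [hg0]
    · rw [Finset.card_image_of_injective _ (fun i j h => hinj i j h),
        Finset.card_erase_of_mem (Finset.mem_univ _)]
      simp [ZMod.card]
  have hsum : ∀ f : ZMod p → ℚ, ∑ i : Fin (p - 1), f (g ^ (i : ℕ)) = (∑ x, f x) - f 0 := by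
    intro f
    rw [← Finset.sum_erase_add _ _ (Finset.mem_univ (0 : ZMod p)), ← himg,
      Finset.sum_image (fun i _ j _ h => hinj i j h)]
    ring
  let v : ZMod p → Fin (p - 1) → ℚ := fun x j =>
    if x = 0 then -1 else if g ^ (j : ℕ) = x then 1 else 0
  have hYv : ∀ i j, Y i j = v (g ^ (i : ℕ) + 1) j := hY
  have hv0 : ∀ j, ∑ x, v x j = 0 := by
    intro j
    have h : ∀ x, v x j = (if x = g ^ (j : ℕ) then (1 : ℚ) else 0) - (if x = 0 then 1 else 0) := by
      intro x
      have := pow_ne_zero (j : ℕ) hg0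
      simp only [v]
      grind
    simp [h, Finset.sum_sub_distrib]
  have hshift : ∀ x j, ∑ i, v x i * Y i j = v (x + 1) j := by
    intro x j
    by_cases hx : x = 0
    · subst hx
      have h1 : ∀ i, v 0 i * Y i j = - v (g ^ (i : ℕ) + 1) j := by
        intro i; rw [hYv, show v 0 i = -1 from if_pos rfl]; ring
      simp only [h1, Finset.sum_neg_distrib]
      rw [hsum (fun x => v (x + 1) j)]
      have := Equiv.sum_comp (Equiv.addRight (1 : ZMod p)) (fun x => v x j)
      simp only [Equiv.coe_addRight] at this
      rw [this, hv0]; ring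
    · have : x ∈ (Finset.univ : Finset (Fin (p - 1))).image (fun i : Fin (p - 1) => g ^ (i : ℕ)) := by
        rw [himg]; simp [hx]
      simp only [Finset.mem_image, Finset.mem_univ, true_and] at this
      obtain ⟨i, rfl⟩ := this
      rw [Finset.sum_eq_single i]
      · simp [v, hg0, hYv]
      · intro k _ hk
        have : g ^ (k : ℕ) ≠ g ^ (i : ℕ) := fun h => hk (hinj _ _ h)
        simp [v, hg0, this]
      · simp
  have hpow : ∀ (k : ℕ) i j, (Y ^ k) i j = v (g ^ (i : ℕ) + (k : ZMod p)) j := by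
    intro k
    induction k with
    | zero =>
      intro i j
      by_cases h : i = j
      · subst h; simp [v, hg0]
      · have : g ^ (j : ℕ) ≠ g ^ (i : ℕ) := fun h' => h (hinj _ _ h').symm
        simp [v, hg0, this, Matrix.one_apply, h]
    | succ k ih =>
      intro i j
      rw [pow_succ, Matrix.mul_apply]
      simp only [ih]
      rw [hshift]
      push_cast
      rw [add_assoc]
  have hrange : ∀ f : ZMod p → ℚ, ∑ k ∈ Finset.range p, f (k : ZMod p) = ∑ x, f x := by
    intro f
    refine Finset.sum_bij' (fun k _ => (k : ZMod p)) (fun x _ => x.val) ?_ ?_ ?_ ?_ ?_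
    · simp
    · intro x _; simpa using ZMod.val_lt x
    · intro k hk; exact ZMod.val_cast_of_lt (by simpa using hk)
    · simp
    · simp
  have hall : ∑ k ∈ Finset.range p, Y ^ k = 0 := by
    ext i j
    rw [Matrix.sum_apply]
    simp only [hpow]
    rw [hrange (fun x => v (g ^ (i : ℕ) + x) j)]
    have := Equiv.sum_comp (Equiv.addLeft (g ^ (i : ℕ))) (fun x => v x j)
    simp only [Equiv.coe_addLeft] at this
    rw [this, hv0]; rfl
  have hset : Finset.range p = insert 0 (Finset.Icc 1 (p - 1)) := by
    ext k; simp; omega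
  rw [hset, Finset.sum_insert (by simp), pow_zero] at hall
  exact eq_neg_of_add_eq_zero_right hall
end

section
/- For every natural number i, the matrix Y^i (with its rational entries viewed in K) satisfies Y^i·v = β^i·v componentwise, where v is the column vector (v_0, v_1, …, v_{p−2}) with v_m = β^{r^m}; that is, Σ_{l=0}^{p−2} (Y^i)_{m,l}·β^{r^l} = β^i·β^{r^m} for every m with 0 ≤ m ≤ p−2. -/
/-- For every `i`, the matrix power `Y^i` (entries viewed in `K`) satisfies
`Y^i · v = β^i · v` componentwise, where `v_m = β^{r^m}`. -/
theorem stmt_10 (p : ℕ) (hp : p.Prime) (K : Type*) [Field K] [Algebra ℚ K]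
    (β : K) (hβ : IsPrimitiveRoot β p)
    (r : ℕ) (hr : orderOf (r : ZMod p) = p - 1)
    (Y : Matrix (Fin (p - 1)) (Fin (p - 1)) ℚ)
    (hY : ∀ i j, Y i j =
      if (r : ZMod p) ^ (i : ℕ) + 1 = 0 then -1
      else if (r : ZMod p) ^ (j : ℕ) = (r : ZMod p) ^ (i : ℕ) + 1 then 1 else 0) :
    ∀ (i : ℕ) (m : Fin (p - 1)),
      ∑ l : Fin (p - 1), ((Y ^ i) m l : K) * β ^ (r ^ (l : ℕ)) =
        β ^ i * β ^ (r ^ (m : ℕ)) := by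
  classical
  have : Fact p.Prime := ⟨hp⟩
  have : CharZero K := algebraRat.charZero K
  have hβp : β ^ p = 1 := hβ.pow_eq_one
  have hp1 : 1 < p := hp.one_lt
  have hr0 : (r : ZMod p) ≠ 0 := by
    intro h0
    have h1 := pow_orderOf_eq_one (r : ZMod p)
    rw [hr, h0, zero_pow (by omega)] at h1
    exact zero_ne_one h1
  have hg : ∀ n : ℕ, β ^ n = β ^ ((n : ZMod p).val) := by
    intro n
    rw [ZMod.val_natCast]
    exact pow_eq_pow_mod n hβp
  have hcong : ∀ a b : ℕ, (a : ZMod p) = b → β ^ a = β ^ b := by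
    intro a b h
    rw [hg a, hg b, h]
  have hinj : Function.Injective (fun l : Fin (p - 1) => (r : ZMod p) ^ (l : ℕ)) := by
    intro a b h
    apply Fin.ext
    apply pow_injOn_Iio_orderOf (x := (r : ZMod p)) _ _ h
    · simp [hr]
    · simp [hr]
  have himg : Finset.univ.image (fun l : Fin (p - 1) => (r : ZMod p) ^ (l : ℕ))
      = Finset.univ.erase 0 := by
    apply Finset.eq_of_subset_of_card_le
    · intro x hx
      obtain ⟨l, -, rfl⟩ := Finset.mem_image.1 hx
      simp [hr0]
    · rw [Finset.card_image_of_injective _ hinj, Finset.card_erase_of_mem (Finset.mem_univ _)]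
      simp [ZMod.card]
  have hsum0 : ∑ x : ZMod p, β ^ x.val = 0 := by
    rw [← hβ.geom_sum_eq_zero hp1]
    refine Finset.sum_bij (fun x _ => x.val) ?_ ?_ ?_ ?_
    · intro x _
      exact Finset.mem_range.2 (ZMod.val_lt x)
    · intro x _ y _ h
      exact ZMod.val_injective p h
    · intro n hn
      exact ⟨(n : ZMod p), Finset.mem_univ _, ZMod.val_cast_of_lt (Finset.mem_range.1 hn)⟩
    · intro x _
      rfl
  have hsum : ∑ l : Fin (p - 1), β ^ (r ^ (l : ℕ)) = -1 := by
    have h1 : ∑ l : Fin (p - 1), β ^ (r ^ (l : ℕ))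
        = ∑ x ∈ Finset.univ.erase (0 : ZMod p), β ^ x.val := by
      rw [← himg, Finset.sum_image (fun a _ b _ h => hinj h)]
      refine Finset.sum_congr rfl fun l _ => ?_
      rw [hg, Nat.cast_pow]
    have h2 := Finset.add_sum_erase Finset.univ (fun x : ZMod p => β ^ x.val)
      (Finset.mem_univ 0)
    rw [hsum0, ← h1] at h2
    simp only [ZMod.val_zero, pow_zero] at h2
    linear_combination h2
  have hbase : ∀ m : Fin (p - 1),
      ∑ l : Fin (p - 1), ((Y m l : ℚ) : K) * β ^ (r ^ (l : ℕ)) = β * β ^ (r ^ (m : ℕ)) := by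
    intro m
    have hR : β * β ^ (r ^ (m : ℕ)) = β ^ (r ^ (m : ℕ) + 1) := by ring
    rw [hR]
    by_cases hm : (r : ZMod p) ^ (m : ℕ) + 1 = 0
    · have h1 : β ^ (r ^ (m : ℕ) + 1) = 1 := by
        rw [hcong _ 0 (by push_cast; exact hm), pow_zero]
      rw [h1]
      simp only [hY, hm, if_true, Rat.cast_neg, Rat.cast_one, neg_mul, one_mul,
        Finset.sum_neg_distrib, hsum, neg_neg]
    · have hmem : (r : ZMod p) ^ (m : ℕ) + 1 ∈
          Finset.univ.image (fun l : Fin (p - 1) => (r : ZMod p) ^ (l : ℕ)) := by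
        rw [himg]
        simp [hm]
      obtain ⟨l0, -, hl0⟩ := Finset.mem_image.1 hmem
      rw [Finset.sum_eq_single l0]
      · rw [hY, if_neg hm, if_pos hl0, Rat.cast_one, one_mul]
        apply hcong
        push_cast
        exact hl0
      · intro b _ hb
        rw [hY, if_neg hm, if_neg, Rat.cast_zero, zero_mul]
        intro h
        exact hb (hinj (h.trans hl0.symm))
      · intro h
        exact absurd (Finset.mem_univ _) h
  intro i
  induction i with
  | zero =>
    intro m
    simp [Matrix.one_apply, apply_ite (Rat.cast : ℚ → K)]
  | succ i ih =>
    intro m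
    calc ∑ l : Fin (p - 1), ((Y ^ (i + 1)) m l : K) * β ^ (r ^ (l : ℕ))
        = ∑ l : Fin (p - 1), ∑ k : Fin (p - 1),
            ((Y ^ i) m k : K) * ((Y k l : K) * β ^ (r ^ (l : ℕ))) := by
          refine Finset.sum_congr rfl fun l _ => ?_
          rw [pow_succ, Matrix.mul_apply, Rat.cast_sum, Finset.sum_mul]
          refine Finset.sum_congr rfl fun k _ => ?_
          rw [Rat.cast_mul, mul_assoc]
      _ = ∑ k : Fin (p - 1), ((Y ^ i) m k : K) * (β * β ^ (r ^ (k : ℕ))) := by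
          rw [Finset.sum_comm]
          refine Finset.sum_congr rfl fun k _ => ?_
          rw [← Finset.mul_sum, hbase]
      _ = β * ∑ k : Fin (p - 1), ((Y ^ i) m k : K) * β ^ (r ^ (k : ℕ)) := by
          rw [Finset.mul_sum]
          refine Finset.sum_congr rfl fun k _ => ?_
          ring
      _ = β ^ (i + 1) * β ^ (r ^ (m : ℕ)) := by
          rw [ih]
          ring
end

section
/- For every natural number j with 1 ≤ j ≤ p−1 and all indices m, l ∈ {0,…,p−2}, the (m,l) entry of the matrix power Y^j is: −1 if r^m + j ≡ 0 (mod p); otherwise, 1 if r^l ≡ r^m + j (mod p), and 0 otherwise. In particular, each row of Y^j is either a standard basis vector or the all-(−1) row. -/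
/-- Entries of the powers `Y^j` for `1 ≤ j ≤ p-1`: the `(m,l)` entry is `-1` if
`r^m + j ≡ 0 (mod p)`, `1` if `r^l ≡ r^m + j (mod p)`, and `0` otherwise. -/
theorem stmt_11 (p : ℕ) (hp : p.Prime)
    (r : ℕ) (hr : orderOf (r : ZMod p) = p - 1)
    (Y : Matrix (Fin (p - 1)) (Fin (p - 1)) ℚ)
    (hY : ∀ i j, Y i j =
      if (r : ZMod p) ^ (i : ℕ) + 1 = 0 then -1
      else if (r : ZMod p) ^ (j : ℕ) = (r : ZMod p) ^ (i : ℕ) + 1 then 1 else 0) :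
    ∀ j : ℕ, 1 ≤ j → j ≤ p - 1 → ∀ m l : Fin (p - 1),
      (Y ^ j) m l =
        if (r : ZMod p) ^ (m : ℕ) + (j : ZMod p) = 0 then -1
        else if (r : ZMod p) ^ (l : ℕ) = (r : ZMod p) ^ (m : ℕ) + (j : ZMod p) then 1
        else 0 := by
  haveI : Fact p.Prime := ⟨hp⟩
  have hp2 := hp.two_le
  have hpos : 0 < orderOf (r : ZMod p) := by omega
  have hr0 : (r : ZMod p) ≠ 0 := by
    intro h
    have h1 := pow_orderOf_eq_one (r : ZMod p)
    rw [h] at h1 hpos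
    rw [zero_pow hpos.ne'] at h1
    exact zero_ne_one h1
  have hpw : ∀ n : ℕ, (r : ZMod p) ^ n ≠ 0 := fun n => pow_ne_zero n hr0
  have hinj : Function.Injective (fun i : Fin (p - 1) => (r : ZMod p) ^ (i : ℕ)) := by
    intro a b hab
    apply Fin.ext
    exact pow_injOn_Iio_orderOf (by simp [hr]) (by simp [hr]) hab
  have himg : Finset.univ.image (fun i : Fin (p - 1) => (r : ZMod p) ^ (i : ℕ))
      = Finset.univ.erase 0 := by
    apply Finset.eq_of_subset_of_card_le
    · intro x hx
      obtain ⟨i, -, rfl⟩ := Finset.mem_image.mp hx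
      simp [hr0]
    · rw [Finset.card_image_of_injective _ hinj, Finset.card_erase_of_mem (Finset.mem_univ _)]
      simp [ZMod.card]
  have hsurj : ∀ x : ZMod p, x ≠ 0 → ∃ i : Fin (p - 1), (r : ZMod p) ^ (i : ℕ) = x := by
    intro x hx
    have : x ∈ Finset.univ.image (fun i : Fin (p - 1) => (r : ZMod p) ^ (i : ℕ)) := by
      rw [himg]; simp [hx]
    simpa using this
  have hsum : ∀ f : ZMod p → ℚ,
      f 0 + ∑ i : Fin (p - 1), f ((r : ZMod p) ^ (i : ℕ)) = ∑ x, f x := by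
    intro f
    rw [← Finset.add_sum_erase _ f (Finset.mem_univ 0), ← himg,
      Finset.sum_image (fun a _ b _ h => hinj h)]
  obtain ⟨v, hv⟩ : ∃ v : ZMod p → Fin (p - 1) → ℚ, ∀ x l, v x l =
      if x = 0 then -1 else if (r : ZMod p) ^ (l : ℕ) = x then 1 else 0 := ⟨_, fun _ _ => rfl⟩
  have hYv : ∀ i l, Y i l = v ((r : ZMod p) ^ (i : ℕ) + 1) l := by
    intro i l; rw [hY, hv]
  have hv0 : ∀ l, ∑ x, v x l = 0 := by
    intro l
    rw [← hsum (fun x => v x l)]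
    have : ∀ i : Fin (p - 1), v ((r : ZMod p) ^ (i : ℕ)) l = if l = i then 1 else 0 := by
      intro i
      rw [hv, if_neg (hpw _)]
      exact if_congr ⟨fun h => hinj h, fun h => by rw [h]⟩ rfl rfl
    simp only [this]
    simp [hv]
  have hstep : ∀ x l, ∑ i, v x i * Y i l = v (x + 1) l := by
    intro x l
    by_cases hx : x = 0
    · subst hx
      have h1 := hsum (fun x => v (x + 1) l)
      have h2 : ∑ x, v (x + 1) l = ∑ x, v x l :=
        Equiv.sum_comp (Equiv.addRight (1 : ZMod p)) (fun x => v x l)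
      simp only [h2, hv0] at h1
      have h3 : ∀ i, v 0 i = -1 := by intro i; simp [hv]
      simp only [h3, hYv, neg_one_mul, Finset.sum_neg_distrib]
      linarith
    · obtain ⟨k, rfl⟩ := hsurj x hx
      have : ∀ i : Fin (p - 1), v ((r : ZMod p) ^ (k : ℕ)) i = if i = k then 1 else 0 := by
        intro i
        rw [hv, if_neg (hpw _)]
        exact if_congr ⟨fun h => hinj h, fun h => by rw [h]⟩ rfl rfl
      simp [this, hYv]
  have key : ∀ j : ℕ, ∀ m l : Fin (p - 1),
      (Y ^ j) m l = v ((r : ZMod p) ^ (m : ℕ) + (j : ZMod p)) l := by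
    intro j
    induction j with
    | zero =>
      intro m l
      rw [pow_zero, Nat.cast_zero, add_zero, hv, if_neg (hpw _), Matrix.one_apply]
      exact if_congr ⟨fun h => by rw [h], fun h => (hinj h).symm⟩ rfl rfl
    | succ j ih =>
      intro m l
      rw [pow_succ, Matrix.mul_apply]
      simp only [ih]
      rw [hstep, Nat.cast_succ, add_assoc]
  intro j _ _ m l
  rw [key, hv]
end

section
/- Let c : ℤ/pℤ → ℚ be any function with c(0) = 0. Define the (p−1)×(p−1) rational matrices P and Q (indices 0,…,p−2) by P_{i,j} = c(i − j) (difference computed in ℤ/pℤ, so the diagonal of P is zero) and Q_{i,j} = c(i+1) (value in ℤ/pℤ). Then A · (Σ_{j=1}^{p−1} c(j)·Y^j) = (P − Q) · A. (Equivalently, every element of the subspace 𝓛₀ = span{Y^j} has the form A^{−1}(P − Q)A.) -/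
lemma sum_aux (p : ℕ) [Fact p.Prime] (g : Fin (p - 1) → ZMod p) (hg : Function.Injective g)
    (h0 : ∀ i, g i ≠ 0) (f : ZMod p → ℚ) : ∑ i, f (g i) + f 0 = ∑ y, f y := by
  classical
  have him : Finset.univ.image g = Finset.univ.erase 0 := by
    apply Finset.eq_of_subset_of_card_le
    · intro y hy
      obtain ⟨i, -, rfl⟩ := Finset.mem_image.1 hy
      simp [h0 i]
    · rw [Finset.card_image_of_injective _ hg, Finset.card_erase_of_mem (Finset.mem_univ _)]
      simp [ZMod.card]
  rw [← Finset.sum_erase_add _ _ (Finset.mem_univ (0 : ZMod p)), ← him,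
    Finset.sum_image (fun a _ b _ h => hg h)]

lemma cast_succ_ne (p : ℕ) [Fact p.Prime] (i : Fin (p - 1)) :
    (((i : ℕ) + 1 : ℕ) : ZMod p) ≠ 0 := by
  intro h
  rw [ZMod.natCast_eq_zero_iff] at h
  have := Nat.le_of_dvd (by omega) h
  omega

lemma cast_succ_inj (p : ℕ) [Fact p.Prime] :
    Function.Injective (fun i : Fin (p - 1) => (((i : ℕ) + 1 : ℕ) : ZMod p)) := by
  intro i j h
  have h' := (ZMod.natCast_eq_natCast_iff' _ _ _).1 h
  rw [Nat.mod_eq_of_lt (by omega), Nat.mod_eq_of_lt (by omega)] at h'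
  ext; omega

/-- For `c : ZMod p → ℚ` with `c 0 = 0`, with `P i j = c (i - j)` and `Q i j = c (i + 1)`
(computed in `ZMod p`), one has `A · (∑_{j=1}^{p-1} c j • Y^j) = (P - Q) · A`. -/
theorem stmt_15 (p : ℕ) (hp : p.Prime)
    (r : ℕ) (hr : orderOf (r : ZMod p) = p - 1)
    (Y A : Matrix (Fin (p - 1)) (Fin (p - 1)) ℚ)
    (hY : ∀ i j, Y i j =
      if (r : ZMod p) ^ (i : ℕ) + 1 = 0 then -1
      else if (r : ZMod p) ^ (j : ℕ) = (r : ZMod p) ^ (i : ℕ) + 1 then 1 else 0)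
    (hA : ∀ i j, A i j =
      if (r : ZMod p) ^ (j : ℕ) = -(((i : ℕ) + 1 : ℕ) : ZMod p) then 1 else 0)
    (c : ZMod p → ℚ) (hc : c 0 = 0)
    (P Q : Matrix (Fin (p - 1)) (Fin (p - 1)) ℚ)
    (hP : ∀ i j, P i j = c (((i : ℕ) : ZMod p) - ((j : ℕ) : ZMod p)))
    (hQ : ∀ i j, Q i j = c (((i : ℕ) + 1 : ℕ) : ZMod p)) :
    A * (∑ j ∈ Finset.Icc 1 (p - 1), c (j : ZMod p) • Y ^ j) = (P - Q) * A := by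
  classical
  haveI : Fact p.Prime := ⟨hp⟩
  have hp2 := hp.two_le
  have hr0 : (r : ZMod p) ≠ 0 := by
    intro h
    rw [h, orderOf_zero] at hr
    omega
  have ginj : Function.Injective (fun i : Fin (p - 1) => (r : ZMod p) ^ (i : ℕ)) := by
    intro i j h
    have := pow_injOn_Iio_orderOf (x := (r : ZMod p)) (by simp [hr]) (by simp [hr]) h
    exact Fin.ext this
  have g0 : ∀ i : Fin (p - 1), (r : ZMod p) ^ (i : ℕ) ≠ 0 := fun i => pow_ne_zero _ hr0
  have gsum := sum_aux p _ ginj g0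
  let E : ZMod p → Fin (p - 1) → ℚ := fun x j =>
    if x = 0 then -1 else if (r : ZMod p) ^ (j : ℕ) = x then 1 else 0
  have hYE : ∀ i, Y i = E ((r : ZMod p) ^ (i : ℕ) + 1) := by
    intro i; ext j; rw [hY]
  have hAE : ∀ i, A i = E (-(((i : ℕ) + 1 : ℕ) : ZMod p)) := by
    intro i; ext j; rw [hA]
    simp only [E]
    rw [if_neg (neg_ne_zero.2 (cast_succ_ne p i))]
  have hE0 : ∀ m, ∑ y, E y m = 0 := by
    intro m
    rw [← gsum (fun y => E y m)]
    have : ∀ i : Fin (p - 1), E ((r : ZMod p) ^ (i : ℕ)) m = if m = i then 1 else 0 := by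
      intro i
      simp only [E, if_neg (g0 i)]
      congr 1
      exact propext ⟨fun h => ginj h, fun h => by rw [h]⟩
    simp only [this]
    simp [E]
  have hstep : ∀ x, Matrix.vecMul (E x) Y = E (x + 1) := by
    intro x
    ext m
    have hexp : ∀ x, Matrix.vecMul (E x) Y m
        = ∑ i : Fin (p - 1), E x i * E ((r : ZMod p) ^ (i : ℕ) + 1) m := by
      intro x
      simp only [Matrix.vecMul, dotProduct, ← hYE]
    rw [hexp]
    by_cases hx : x = 0
    · subst hx
      have h1 := gsum (fun y => E (y + 1) m)
      have h2 : ∑ y, E (y + 1) m = 0 := by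
        rw [← hE0 m]
        exact Equiv.sum_comp (Equiv.addRight (1 : ZMod p)) (fun y => E y m)
      have h3 : ∀ i, E 0 i = -1 := fun i => by simp [E]
      simp only [h3, neg_one_mul, Finset.sum_neg_distrib]
      linarith
    · have h1 := gsum (fun y => if y = x then E (x + 1) m else 0)
      rw [if_neg (Ne.symm hx), Finset.sum_ite_eq' Finset.univ x, if_pos (Finset.mem_univ _),
        add_zero] at h1
      rw [← h1]
      refine Finset.sum_congr rfl fun i _ => ?_
      by_cases h : (r : ZMod p) ^ (i : ℕ) = x
      · have : E x i = 1 := by simp only [E, if_neg hx, if_pos h]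
        rw [this, if_pos h, h, one_mul]
      · have : E x i = 0 := by simp only [E, if_neg hx, if_neg h]
        rw [this, if_neg h, zero_mul]
  have hpow : ∀ (k : ℕ) x, Matrix.vecMul (E x) (Y ^ k) = E (x + k) := by
    intro k
    induction k with
    | zero => intro x; simp
    | succ k ih =>
      intro x
      rw [pow_succ, ← Matrix.vecMul_vecMul, ih, hstep]
      push_cast
      rw [add_assoc]
  have hAY : ∀ (k : ℕ) i m, (A * Y ^ k) i m = E (-(((i : ℕ) + 1 : ℕ) : ZMod p) + k) m := by
    intro k i m
    rw [← hpow, ← hAE]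
    rfl
  ext i m
  set a : ZMod p := (((i : ℕ) + 1 : ℕ) : ZMod p) with ha
  have hL : (A * (∑ j ∈ Finset.Icc 1 (p - 1), c (j : ZMod p) • Y ^ j)) i m
      = ∑ y, c y * E (-a + y) m := by
    rw [Finset.mul_sum, Matrix.sum_apply]
    simp only [Matrix.mul_smul, Matrix.smul_apply, hAY, smul_eq_mul]
    rw [← sum_aux p _ (cast_succ_inj p) (cast_succ_ne p) (fun y => c y * E (-a + y) m), hc,
      zero_mul, add_zero,
      Fin.sum_univ_eq_sum_range (fun n => c ((n + 1 : ℕ) : ZMod p) * E (-a + ((n + 1 : ℕ) : ZMod p)) m),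
      Finset.sum_bij (fun n _ => n - 1)]
    · intro n hn; simp at hn ⊢; omega
    · intro n hn k hk h; simp at hn hk; omega
    · intro n hn; exact ⟨n + 1, by simp at hn ⊢; omega, by simp⟩
    · intro n hn
      simp only [Finset.mem_Icc] at hn
      rw [Nat.sub_add_cancel hn.1]
  have hR : ((P - Q) * A) i m = ∑ y, c (a + y) * E y m := by
    have h1 := sum_aux p (fun j : Fin (p - 1) => -(((j : ℕ) + 1 : ℕ) : ZMod p))
      (fun x y h => cast_succ_inj p (neg_injective h)) (fun j => neg_ne_zero.2 (cast_succ_ne p j))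
      (fun y => (c (a + y) - c a) * E y m)
    simp only [add_zero, sub_self, zero_mul, sub_mul, Finset.sum_sub_distrib] at h1
    rw [← Finset.mul_sum Finset.univ (fun y => E y m), hE0, mul_zero, sub_zero] at h1
    rw [← h1, Matrix.mul_apply, ← Finset.sum_sub_distrib]
    refine Finset.sum_congr rfl fun j _ => ?_
    rw [Matrix.sub_apply, hP, hQ, hAE, sub_mul]
    congr 4
    rw [ha]; push_cast; ring
  rw [hL, hR, ← Equiv.sum_comp (Equiv.addLeft a)]
  simp
end

section
/- Let n be a natural number and let M, A, B be n×n matrices over ℚ with M ≠ A·B. Then the number of vectors y ∈ {0,1}^n (viewed as rational vectors) such that M·y ≠ (A·B)·y is at least 2^{n−1}. Equivalently, for a uniformly random y ∈ {0,1}^n, the probability that M·y ≠ A·B·y is at least 1/2. -/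
/-- Freivalds: if `M ≠ A·B`, then at least `2^{n-1}` of the `2^n` zero–one vectors `y`
satisfy `M·y ≠ (A·B)·y`. -/
theorem stmt_16 (n : ℕ) (M A B : Matrix (Fin n) (Fin n) ℚ) (h : M ≠ A * B) :
    2 ^ (n - 1) ≤
      Set.ncard {y : Fin n → ℚ |
        (∀ i, y i = 0 ∨ y i = 1) ∧ M.mulVec y ≠ (A * B).mulVec y} := by
  classical
  generalize A * B = C at h ⊢
  obtain ⟨i, j, hij⟩ : ∃ i j, M i j ≠ C i j := by
    by_contra hc
    push Not at hc
    exact h (Matrix.ext hc)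
  let S : Finset (Fin n → ℚ) := Fintype.piFinset (fun _ => ({0, 1} : Finset ℚ))
  have hS : S.card = 2 ^ n := by simp [S]
  have memS : ∀ y, y ∈ S ↔ ∀ i, y i = 0 ∨ y i = 1 := by
    intro y; simp [S, Fintype.mem_piFinset]
  have hset : {y : Fin n → ℚ | (∀ i, y i = 0 ∨ y i = 1) ∧ M.mulVec y ≠ C.mulVec y}
      = ((S.filter (fun y => ¬ M.mulVec y = C.mulVec y) : Finset _) : Set (Fin n → ℚ)) := by
    ext y; simp [memS]
  rw [hset, Set.ncard_coe_finset]
  have hsum := S.card_filter_add_card_filter_not (fun y => M.mulVec y = C.mulVec y)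
  let f : (Fin n → ℚ) → (Fin n → ℚ) := fun y => y + Pi.single j (1 - 2 * y j)
  have hff : ∀ y, f (f y) = y := by
    intro y
    ext k
    by_cases hk : k = j
    · subst hk; simp [f]; ring
    · simp [f, hk]
  have hle : (S.filter (fun y => M.mulVec y = C.mulVec y)).card ≤
      (S.filter (fun y => ¬ M.mulVec y = C.mulVec y)).card := by
    apply Finset.card_le_card_of_injOn f
    · intro y hy
      simp only [Finset.coe_filter, Set.mem_setOf_eq, memS] at hy ⊢
      obtain ⟨h1, h2⟩ := hy
      refine ⟨fun k => ?_, fun h3 => ?_⟩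
      · by_cases hk : k = j
        · subst hk
          rcases h1 k with h | h <;> simp [f, h] <;> norm_num
        · simpa [f, hk] using h1 k
      · simp only [f, Matrix.mulVec_add, h2] at h3
        have h4 := congrFun (add_left_cancel h3) i
        simp [Matrix.mulVec_single] at h4
        rcases h1 j with h | h <;> rw [h] at h4 <;> norm_num at h4 <;> exact hij h4
    · intro a _ b _ hab
      rw [← hff a, ← hff b, hab]
  obtain ⟨m, rfl⟩ : ∃ m, n = m + 1 := ⟨n - 1, by have := i.pos; omega⟩
  rw [hS, pow_succ] at hsum
  simp only [Nat.add_sub_cancel]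
  omega
end

section
/- Let F be a field, T a positive natural number, let w_1,…,w_T ∈ F be pairwise distinct, and let c_1,…,c_T ∈ F. Define a_ℓ = Σ_{i=1}^T c_i·w_i^ℓ for every natural number ℓ, and let A_T be the T×T Toeplitz matrix over F with (A_T)_{j,k} = a_{(T−1) − j + k} for row and column indices j, k ∈ {0,…,T−1} (its first row is a_{T−1}, a_T, …, a_{2T−2} and its last row is a_0, a_1, …, a_{T−1}). Then the rank of A_T equals the number of indices i with c_i ≠ 0. -/
/-- For pairwise distinct `w_i` and `a_ℓ = ∑ i, c_i w_i^ℓ`, the `T×T` Toeplitz matrix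
with `(j,k)` entry `a_{(T-1)-j+k}` has rank equal to the number of nonzero `c_i`. -/
theorem stmt_19 (F : Type*) [Field F] (T : ℕ) (hT : 0 < T)
    (w c : Fin T → F) (hw : Function.Injective w) (a : ℕ → F)
    (ha : ∀ ℓ : ℕ, a ℓ = ∑ i : Fin T, c i * w i ^ ℓ)
    (AT : Matrix (Fin T) (Fin T) F)
    (hAT : ∀ j k : Fin T, AT j k = a ((T - 1) - (j : ℕ) + (k : ℕ))) :
    AT.rank = Set.ncard {i : Fin T | c i ≠ 0} := by
  classical
  have hV : (Matrix.vandermonde w).det ≠ 0 := Matrix.det_vandermonde_ne_zero_iff.mpr hw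
  have hVt : (Matrix.vandermonde w).transpose.det ≠ 0 := by rwa [Matrix.det_transpose]
  have key : AT.submatrix (Fin.revPerm : Equiv.Perm (Fin T)) (Equiv.refl (Fin T)) =
      (Matrix.vandermonde w).transpose * (Matrix.diagonal c * Matrix.vandermonde w) := by
    ext j k
    have hj : T - 1 - ((Fin.rev j : Fin T) : ℕ) = j := by
      rw [Fin.val_rev]
      have := j.isLt
      omega
    simp only [Matrix.submatrix_apply, Fin.revPerm_apply, Equiv.refl_apply, hAT, ha, hj,
      Matrix.mul_apply (M := (Matrix.vandermonde w).transpose), Matrix.diagonal_mul,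
      Matrix.transpose_apply, Matrix.vandermonde_apply]
    refine Finset.sum_congr rfl fun i _ => ?_
    ring
  rw [← Matrix.rank_submatrix AT (Fin.revPerm : Equiv.Perm (Fin T)) (Equiv.refl (Fin T)), key,
    Matrix.rank_mul_eq_right_of_det_ne_zero _ _ hVt,
    Matrix.rank_mul_eq_left_of_det_ne_zero _ _ hV, Matrix.rank_diagonal,
    ← Nat.card_coe_set_eq, Nat.card_eq_fintype_card]
  rfl
end
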